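/- Let G be a finite connected graph that is claw-free and bull-free, and let C be an induced cycle in G of length k ≥ 6. Then every vertex x of G that is not on C but has a neighbor on C has exactly three neighbors on C, and these three neighbors are consecutive vertices of C. -/

import Mathlib

/-- A graph is claw-free: no induced `K_{1,3}`. -/
def ClawFree {V : Type*} (G : SimpleGraph V) : Prop :=
  ¬ ∃ v a b c : V, a ≠ b ∧ a ≠ c ∧ b ≠ c ∧
    G.Adj v a ∧ G.Adj v b ∧ G.Adj v c ∧ ¬ G.Adj a b ∧ ¬ G.Adj a c ∧ ¬ G.Adj b c

/-- A graph is bull-free: no induced bull (triangle `a b c` with pendants `d` at `a`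
and `e` at `b`). -/
def BullFree {V : Type*} (G : SimpleGraph V) : Prop :=
  ¬ ∃ a b c d e : V, a ≠ e ∧ b ≠ d ∧ c ≠ d ∧ c ≠ e ∧ d ≠ e ∧
    G.Adj a b ∧ G.Adj b c ∧ G.Adj c a ∧ G.Adj a d ∧ G.Adj b e ∧
    ¬ G.Adj b d ∧ ¬ G.Adj c d ∧ ¬ G.Adj a e ∧ ¬ G.Adj c e ∧ ¬ G.Adj d e
/-- `v : ZMod k → V` is an induced cycle of length `k` in `G`: the vertices are distinct and
two of them are adjacent iff their indices differ by `±1` modulo `k`. -/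
def IsInducedCycle {V : Type*} (G : SimpleGraph V) (k : ℕ) (v : ZMod k → V) : Prop :=
  Function.Injective v ∧ ∀ i j : ZMod k, G.Adj (v i) (v j) ↔ (i - j = 1 ∨ j - i = 1)

theorem ZMod.natCast_ne_zero_of_lt {k : ℕ} (n : ℕ) (hn : 0 < n) (hnk : n < k) :
    (n : ZMod k) ≠ 0 := by
  rw [Ne, ZMod.natCast_eq_zero_iff]
  exact fun h => absurd (Nat.le_of_dvd hn h) (by omega)

/-- The neighborhood of `x` on an induced cycle, for a cycle indexed by any commutative ring in
which `1, …, 5` are nonzero (such as `ZMod k` with `6 ≤ k`). -/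
theorem exists_forall_adj_iff_of_clawFree_of_bullFree {V R : Type*} [CommRing R]
    {G : SimpleGraph V} (hclaw : ClawFree G) (hbull : BullFree G)
    (h1 : (1 : R) ≠ 0) (h2 : (2 : R) ≠ 0) (h3 : (3 : R) ≠ 0) (h4 : (4 : R) ≠ 0)
    (h5 : (5 : R) ≠ 0) {v : R → V} (hinj : Function.Injective v)
    (hadj : ∀ i j, G.Adj (v i) (v j) ↔ (i - j = 1 ∨ j - i = 1))
    {x : V} (hx : x ∉ Set.range v) (hxN : ∃ i, G.Adj x (v i)) :
    ∃ i, ∀ j, G.Adj x (v j) ↔ (j = i ∨ j = i + 1 ∨ j = i + 2) := by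
  have hxv : ∀ i, x ≠ v i := fun i h => hx ⟨i, h.symm⟩
  have adj_succ : ∀ i, G.Adj (v i) (v (i + 1)) := fun i => (hadj _ _).2 (.inr (by ring))
  have adj_pred : ∀ i, G.Adj (v i) (v (i - 1)) := fun i => (hadj _ _).2 (.inl (by ring))
  have far : ∀ i j, i ≠ j → i - j ≠ 1 → j - i ≠ 1 → v i ≠ v j ∧ ¬ G.Adj (v i) (v j) :=
    fun i j hij h h' => ⟨hinj.ne hij, by rw [hadj]; tauto⟩
  have far_two : ∀ i j, j = i + 2 → v i ≠ v j ∧ ¬ G.Adj (v i) (v j) := fun i j hij =>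
    far i j (fun h => h2 (by linear_combination -h - hij))
      (fun h => h3 (by linear_combination -h - hij)) (fun h => h1 (by linear_combination h - hij))
  have far_three : ∀ i j, j = i + 3 → v i ≠ v j ∧ ¬ G.Adj (v i) (v j) := fun i j hij =>
    far i j (fun h => h3 (by linear_combination -h - hij))
      (fun h => h4 (by linear_combination -h - hij)) (fun h => h2 (by linear_combination h - hij))
  have far_four : ∀ i j, j = i + 4 → v i ≠ v j ∧ ¬ G.Adj (v i) (v j) := fun i j hij =>
    far i j (fun h => h4 (by linear_combination -h - hij))
      (fun h => h5 (by linear_combination -h - hij)) (fun h => h3 (by linear_combination h - hij))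
  have claw : ∀ a b c, a ≠ b ∧ ¬ G.Adj a b → a ≠ c ∧ ¬ G.Adj a c → b ≠ c ∧ ¬ G.Adj b c →
      G.Adj x a → G.Adj x b → ¬ G.Adj x c := fun a b c hab hac hbc ha hb hc =>
    hclaw ⟨x, a, b, c, hab.1, hac.1, hbc.1, ha, hb, hc, hab.2, hac.2, hbc.2⟩
  obtain ⟨i, hi, hpred⟩ : ∃ i, G.Adj x (v i) ∧ ¬ G.Adj x (v (i - 1)) := by
    by_contra! hall
    obtain ⟨i, hi⟩ := hxN
    have hi2 := hall _ (hall _ hi)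
    have hi4 := hall _ (hall _ hi2)
    exact claw _ _ _ (far_two _ _ (by ring)) (far_four _ _ (by ring)) (far_two _ _ (by ring))
      hi4 hi2 hi
  have far_succ := far_two (i - 1) (i + 1) (by ring)
  have far_add_two := far_three (i - 1) (i + 2) (by ring)
  have far_add_three := far_four (i - 1) (i + 3) (by ring)
  have hi1 : G.Adj x (v (i + 1)) := by
    by_contra h
    exact hclaw ⟨v i, x, v (i - 1), v (i + 1), hxv _, hxv _, far_succ.1, hi.symm, adj_pred i,
      adj_succ i, hpred, h, far_succ.2⟩
  have hi2 : G.Adj x (v (i + 2)) := by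
    by_contra h
    have h02 := far_two i (i + 2) rfl
    exact hbull ⟨v i, v (i + 1), x, v (i - 1), v (i + 2), h02.1, far_succ.1.symm, hxv _, hxv _,
      far_add_two.1, adj_succ i, hi1.symm, hi, adj_pred i, (hadj _ _).2 (.inr (by ring)),
      fun h' => far_succ.2 h'.symm, hpred, h02.2, h, far_add_two.2⟩
  have hi3 : ¬ G.Adj x (v (i + 3)) := by
    intro h
    have h03 := far_three i (i + 3) rfl
    have h13 := far_two (i + 1) (i + 3) (by ring)
    exact hbull ⟨v i, x, v (i + 1), v (i - 1), v (i + 3), h03.1, hxv _, far_succ.1.symm, h13.1,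
      far_add_three.1, hi.symm, hi1, (adj_succ i).symm, adj_pred i, h, hpred,
      fun h' => far_succ.2 h'.symm, h03.2, h13.2, far_add_three.2⟩
  refine ⟨i, fun j => ⟨fun hj => ?_, ?_⟩⟩
  · by_contra! hout
    obtain ⟨hj0, hj1, hj2⟩ := hout
    have hj3 : j ≠ i + 3 := fun h => hi3 (h ▸ hj)
    have hjp : j ≠ i - 1 := fun h => hpred (h ▸ hj)
    exact claw _ _ _ (far_two i (i + 2) rfl)
      (far i j hj0.symm (fun h => hjp (by linear_combination -h))
        (fun h => hj1 (by linear_combination h)))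
      (far (i + 2) j hj2.symm (fun h => hj1 (by linear_combination -h))
        (fun h => hj3 (by linear_combination h))) hi hi2 hj
  · rintro (rfl | rfl | rfl) <;> assumption

/-- In a connected (claw, bull)-free graph, every vertex with a neighbor on an induced cycle
of length `k ≥ 6` (but not on the cycle) has exactly three neighbors on the cycle, and
these are three consecutive vertices of the cycle. -/
theorem exactly_three_consecutive_neighbors {V : Type*} [Fintype V] (G : SimpleGraph V)
    (hconn : G.Connected) (hclaw : ClawFree G) (hbull : BullFree G)
    (k : ℕ) (hk : 6 ≤ k) (v : ZMod k → V) (hC : IsInducedCycle G k v)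
    (x : V) (hx : x ∉ Set.range v) (hxN : ∃ i : ZMod k, G.Adj x (v i)) :
    ∃ i : ZMod k, ∀ j : ZMod k, G.Adj x (v j) ↔ (j = i ∨ j = i + 1 ∨ j = i + 2) := by
  have hne (n : ℕ) (hn : 0 < n) (hn6 : n < 6) : (n : ZMod k) ≠ 0 :=
    ZMod.natCast_ne_zero_of_lt n hn (by omega)
  exact exists_forall_adj_iff_of_clawFree_of_bullFree hclaw hbull
    (by exact_mod_cast hne 1 (by omega) (by omega)) (by exact_mod_cast hne 2 (by omega) (by omega))
    (by exact_mod_cast hne 3 (by omega) (by omega)) (by exact_mod_cast hne 4 (by omega) (by omega))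
    (by exact_mod_cast hne 5 (by omega) (by omega)) hC.1 hC.2 hx hxN
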